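/- Every finite lattice L is a sublattice of the clone lattice Cl(X) over some finite set X; in fact, |X| ≥ |L| + 4 suffices, i.e., for every finite set X with |X| ≥ |L| + 4 there is an injective map from L into Cl(X) preserving finite joins and finite meets. -/

import Mathlib

universe u v

/-- A clone on `X`: a set of finitary operations (of each arity `n + 1 ≥ 1`)
containing all projections and closed under composition. -/
structure Clone (X : Type u) where
  carrier : ∀ n : ℕ, Set ((Fin (n + 1) → X) → X)
  proj_mem : ∀ (n : ℕ) (i : Fin (n + 1)), (fun x => x i) ∈ carrier n
  comp_mem : ∀ {m n : ℕ} (f : (Fin (m + 1) → X) → X)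
      (g : Fin (m + 1) → (Fin (n + 1) → X) → X),
      f ∈ carrier m → (∀ i, g i ∈ carrier n) →
      (fun x => f fun i => g i x) ∈ carrier n

namespace Clone

variable {X : Type u}

theorem carrier_injective : Function.Injective (Clone.carrier (X := X)) := by
  rintro ⟨c, _, _⟩ ⟨d, _, _⟩ h
  simpa using h

instance : PartialOrder (Clone X) where
  le C D := ∀ n, C.carrier n ⊆ D.carrier n
  le_refl _ _ := subset_rfl
  le_trans _ _ _ h₁ h₂ n := (h₁ n).trans (h₂ n)
  le_antisymm _ _ h₁ h₂ :=
    carrier_injective (funext fun n => subset_antisymm (h₁ n) (h₂ n))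

instance : InfSet (Clone X) where
  sInf S :=
    { carrier := fun n => ⋂ C ∈ S, C.carrier n
      proj_mem := fun n i => Set.mem_iInter₂.2 fun C _ => C.proj_mem n i
      comp_mem := fun f g hf hg => Set.mem_iInter₂.2 fun C hC =>
        C.comp_mem f g (Set.mem_iInter₂.1 hf C hC)
          fun i => Set.mem_iInter₂.1 (hg i) C hC }

/-- The lattice `Cl(X)` of all clones on `X` is a complete lattice
(with infima given by intersection). -/
instance : CompleteLattice (Clone X) :=
  completeLatticeOfInf (Clone X) (fun S =>
    ⟨fun C hC n _ hx => Set.mem_iInter₂.1 hx C hC,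
     fun _ hD n _ hx => Set.mem_iInter₂.2 fun C hC => hD hC n hx⟩)

/-- The clone generated by a family `F` of operations:
the smallest clone whose carrier contains `F`. -/
def cloneGen (F : ∀ n : ℕ, Set ((Fin (n + 1) → X) → X)) : Clone X :=
  sInf {C : Clone X | ∀ n, F n ⊆ C.carrier n}

end Clone

set_option linter.unusedSectionVars false

namespace CloneEmb

open Classical

/-- The part of `X` that is used by the construction. -/
inductive W (L : Type u) : Type u
  | e (d : L) : W L
  | z (p : Prop) : W L
  | m (p : Prop) : W L

/-- Names of the distinguished vectors in `L → X`. -/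
inductive Tok (L : Type u) : Type u
  | id : Tok L
  | h (c : L) : Tok L
  | m (c : L) : Tok L

def lev {L : Type u} (a : L) : Tok L → L
  | .id => a
  | .h c => c
  | .m c => c

def wvec {L : Type u} [LE L] : Tok L → L → W L
  | .id, d => .e d
  | .h c, d => .z (¬ c ≤ d)
  | .m c, d => .m (¬ c ≤ d)

/-- The second token equals the first, or the first is not the identity token and the second is a memory token. -/
def Ext1 {L : Type u} (t t' : Tok L) : Prop := t' = t ∨ (t ≠ .id ∧ ∃ c, t' = .m c)

theorem Ext1.trans {L : Type u} {t t' t'' : Tok L} (h : Ext1 t t') (h' : Ext1 t' t'') :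
    Ext1 t t'' := by
  rcases h with rfl | ⟨h1, c, rfl⟩
  · exact h'
  · rcases h' with rfl | ⟨_, c', rfl⟩
    · exact Or.inr ⟨h1, c, rfl⟩
    · exact Or.inr ⟨h1, c', rfl⟩

theorem Ext1.refl {L : Type u} (t : Tok L) : Ext1 t t := Or.inl rfl

section
variable {L : Type u} [Lattice L] [OrderBot L] {X : Type v} (j : W L → X)

def vec (t : Tok L) (d : L) : X := j (wvec t d)

def Dead (v : L → X) : Prop := ∃ d p, v d = j (.m p)
def Live (v : L → X) : Prop := v = vec j .id ∨ ∃ c, v = vec j (.h c)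
def Rel (v : L → X) : Prop := Live j v ∨ Dead j v

noncomputable def hh (a : L) : X → X :=
  Function.extend (fun d => j (.e d)) (fun d => j (.z (¬ a ≤ d))) (fun _ => j (.m False))

def N (x : X) : Prop := x = j (.z True) ∨ x = j (.m True)

def ap {ι : Type*} (F : (ι → X) → X) (σ : ι → L → X) : L → X := fun d => F fun i => σ i d

def Ext {ι : Type*} (F : (ι → X) → X) (I : Set ι) (σ : ι → Tok L) : Prop :=
  ∃ σ0 : ι → Tok L, Live j (ap F fun i => vec j (σ0 i)) ∧ ∀ i ∈ I, Ext1 (σ0 i) (σ i)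

structure Core (a : L) {ι : Type*} (F : (ι → X) → X) (I : Set ι) : Prop where
  dep : ∀ x y : ι → X, (∀ i ∈ I, x i = y i) → F x = F y
  rel : ∀ σ : ι → L → X, (∀ i, Rel j (σ i)) → Rel j (ap F σ)
  kill : ∀ σ : ι → L → X, (∀ i, Rel j (σ i)) → Live j (ap F σ) → ∀ i ∈ I, Live j (σ i)
  typ : ∀ σ σ' : ι → L → X, (∀ i, Rel j (σ i)) → (∀ i, Rel j (σ' i)) →
    Live j (ap F σ) → Live j (ap F σ') → (ap F σ = vec j .id ↔ ap F σ' = vec j .id) →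
    ∀ i ∈ I, (σ i = vec j .id ↔ σ' i = vec j .id)
  ex : ∀ σ : ι → Tok L, Ext j F I σ → ∃ t, ap F (fun i => vec j (σ i)) = vec j t
  mem : ∀ (σ : ι → Tok L) (t : Tok L), Ext j F I σ → ap F (fun i => vec j (σ i)) = vec j t →
    ∀ i ∈ I, ∀ c, σ i = .m c → ∃ c', t = .m c' ∧ c ≤ c'
  idd : ∀ (σ : ι → Tok L) (t : Tok L), Ext j F I σ → ap F (fun i => vec j (σ i)) = vec j t →
    t = .id → ∀ i ∈ I, σ i = .id
  up : ∀ (σ : ι → Tok L) (t : Tok L), Ext j F I σ → ap F (fun i => vec j (σ i)) = vec j t →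
    ∀ u, (∀ i ∈ I, lev a (σ i) ≤ u) → lev a t ≤ u
  cmp : ∀ (σ σ' : ι → Tok L) (t t' : Tok L), Ext j F I σ → Ext j F I σ' →
    (∀ i ∈ I, Ext1 (σ i) (σ' i)) →
    ap F (fun i => vec j (σ i)) = vec j t → ap F (fun i => vec j (σ' i)) = vec j t' →
    ∀ u, lev ⊥ t' ≤ u → (∀ i ∈ I, σ i ≠ σ' i → lev ⊥ (σ i) ≤ u) → lev ⊥ t ≤ u

def NoId {ι : Type*} (F : (ι → X) → X) : Prop :=
  ∀ σ : ι → L → X, (∀ i, Rel j (σ i)) → ap F σ ≠ vec j .id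

def Q (a : L) {ι : Type*} (F : (ι → X) → X) : Prop :=
  ((∃ i, F = fun x => x i) ∨ NoId j F) ∧ ∃ I, Core j a F I

variable {j}
theorem vec_inj (hj : Function.Injective j) {t t' : Tok L} (h : vec j t = vec j t') : t = t' := by
  have h' : ∀ d, wvec t d = wvec t' d := fun d => hj (congrFun h d)
  cases t <;> cases t' <;> simp [wvec] at h' ⊢
  all_goals
    exact eq_of_forall_ge_iff fun d => by have := h' d; tauto

theorem live_not_dead (hj : Function.Injective j) {v : L → X} (h : Live j v) : ¬ Dead j v := by
  rintro ⟨d, p, hd⟩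
  rcases h with rfl | ⟨c, rfl⟩
  · have := hj hd; simp [wvec] at this
  · have := hj hd; simp [wvec] at this

theorem rel_vec (t : Tok L) : Rel j (vec j t) := by
  cases t with
  | id => exact Or.inl (Or.inl rfl)
  | h c => exact Or.inl (Or.inr ⟨c, rfl⟩)
  | m c => exact Or.inr ⟨⊥, _, rfl⟩

theorem live_vec (hj : Function.Injective j) {t : Tok L} (h : Live j (vec j t)) : ∀ c, t ≠ .m c := by
  rintro c rfl
  exact live_not_dead hj h ⟨⊥, _, rfl⟩

theorem live_tok {v : L → X} (h : Live j v) : ∃ t, v = vec j t := by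
  rcases h with rfl | ⟨c, rfl⟩
  exacts [⟨_, rfl⟩, ⟨_, rfl⟩]

theorem hh_e (hj : Function.Injective j) (a d : L) : hh j a (j (.e d)) = j (.z (¬ a ≤ d)) := by
  have : Function.Injective (fun d : L => j (.e d)) := fun x y h => by simpa using hj h
  exact this.extend_apply _ _ d

theorem hh_ne (a : L) (x : X) (h : ∀ d, j (.e d) ≠ x) : hh j a x = j (.m False) :=
  Function.extend_apply' _ _ _ (by simpa using h)

theorem hh_z (hj : Function.Injective j) (a : L) (p : Prop) : hh j a (j (.z p)) = j (.m False) :=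
  hh_ne _ _ fun d h => by simpa using hj h

theorem hh_m (hj : Function.Injective j) (a : L) (p : Prop) : hh j a (j (.m p)) = j (.m False) :=
  hh_ne _ _ fun d h => by simpa using hj h

theorem N_vec (hj : Function.Injective j) (t : Tok L) (d : L) : N j (vec j t d) ↔ ¬ lev ⊥ t ≤ d := by
  cases t <;> simp [N, vec, wvec, hj.eq_iff, lev]

theorem mono_tok {a : L} {ι : Type*} {F : (ι → X) → X} {I : Set ι} (hF : Core j a F I)
    (hj : Function.Injective j)
    {σ σ' : ι → Tok L} {t t' : Tok L} (h : Ext j F I σ) (h' : Ext j F I σ')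
    (hs : ∀ i ∈ I, Ext1 (σ i) (σ' i))
    (ht : ap F (fun i => vec j (σ i)) = vec j t) (ht' : ap F (fun i => vec j (σ' i)) = vec j t') :
    Ext1 t t' := by
  by_cases hc : ∀ i ∈ I, σ' i = σ i
  · left
    apply vec_inj hj
    rw [← ht, ← ht']
    funext d
    exact hF.dep _ _ fun i hi => by simp only [hc i hi]
  · push Not at hc
    obtain ⟨i, hi, hne⟩ := hc
    rcases hs i hi with h1 | ⟨h1, c, h2⟩
    · exact absurd h1 hne
    · right
      refine ⟨fun h3 => h1 (hF.idd σ t h ht h3 i hi), ?_⟩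
      obtain ⟨c', hc', _⟩ := hF.mem σ' t' h' ht' i hi c h2
      exact ⟨c', hc'⟩

theorem core_proj (hj : Function.Injective j) (a : L) {ι : Type*} (i : ι) : Core j a (fun x : ι → X => x i) {i} where
  dep x y h := h i rfl
  rel σ h := h i
  kill σ _ h k hk := by rw [Set.mem_singleton_iff.1 hk]; exact h
  typ σ σ' _ _ _ _ h k hk := by rw [Set.mem_singleton_iff.1 hk]; exact h
  ex σ _ := ⟨σ i, rfl⟩
  mem σ t _ h k hk c hc := by
    rw [Set.mem_singleton_iff.1 hk] at hc
    have : σ i = t := vec_inj hj h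
    exact ⟨c, by rw [← this, hc], le_rfl⟩
  idd σ t _ h ht k hk := by
    rw [Set.mem_singleton_iff.1 hk]
    have : σ i = t := vec_inj hj h
    rw [this, ht]
  up σ t _ h u hu := by
    have : σ i = t := vec_inj hj h
    rw [← this]; exact hu i rfl
  cmp σ σ' t t' _ _ _ h h' u hu hc := by
    have h1 : σ i = t := vec_inj hj h
    have h2 : σ' i = t' := vec_inj hj h'
    by_cases h3 : σ i = σ' i
    · rw [← h1, h3, h2]; exact hu
    · rw [← h1]; exact hc i rfl h3

theorem core_comp (hj : Function.Injective j) (a : L) {κ ι : Type*} {F : (κ → X) → X} {I : Set κ} (hF : Core j a F I)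
    {g : κ → (ι → X) → X} {J : κ → Set ι} (hg : ∀ k, Core j a (g k) (J k)) :
    Core j a (fun x => F fun k => g k x) {i | ∃ k ∈ I, i ∈ J k} := by
  set K : Set ι := {i | ∃ k ∈ I, i ∈ J k} with hK
  have hap : ∀ σ : ι → L → X, ap (fun x => F fun k => g k x) σ = ap F fun k => ap (g k) σ :=
    fun _ => rfl
  -- extension passes down to the components
  have down : ∀ σ, Ext j (fun x => F fun k => g k x) K σ → ∀ k ∈ I, Ext j (g k) (J k) σ := by
    rintro σ ⟨σ0, h0, h1⟩ k hk
    refine ⟨σ0, ?_, fun i hi => h1 i ⟨k, hk, hi⟩⟩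
    exact hF.kill (fun k => ap (g k) fun i => vec j (σ0 i))
      (fun k => (hg k).rel _ fun i => rel_vec _) h0 k hk
  have main : ∀ σ, Ext j (fun x => F fun k => g k x) K σ → ∃ τ : κ → Tok L,
      (∀ k ∈ I, ap (g k) (fun i => vec j (σ i)) = vec j (τ k)) ∧ Ext j F I τ ∧
      ap (fun x => F fun k => g k x) (fun i => vec j (σ i)) = ap F fun k => vec j (τ k) := by
    intro σ hσ
    have sub : ∀ σ, Ext j (fun x => F fun k => g k x) K σ → ∃ τ : κ → Tok L,
        (∀ k ∈ I, ap (g k) (fun i => vec j (σ i)) = vec j (τ k)) ∧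
        ap (fun x => F fun k => g k x) (fun i => vec j (σ i)) = ap F fun k => vec j (τ k) := by
      intro σ hσ
      have : ∀ k, ∃ t, k ∈ I → ap (g k) (fun i => vec j (σ i)) = vec j t := by
        intro k
        by_cases hk : k ∈ I
        · obtain ⟨t, ht⟩ := (hg k).ex σ (down σ hσ k hk)
          exact ⟨t, fun _ => ht⟩
        · exact ⟨.id, fun h => absurd h hk⟩
      choose τ hτ using this
      refine ⟨τ, hτ, ?_⟩
      funext d
      exact hF.dep _ _ fun k hk => congrFun (hτ k hk) d
    obtain ⟨τ, h1, h2⟩ := sub σ hσ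
    refine ⟨τ, h1, ?_, h2⟩
    obtain ⟨σ0, h0, h0'⟩ := hσ
    have hσ' : Ext j (fun x => F fun k => g k x) K σ := ⟨σ0, h0, h0'⟩
    have hσ0 : Ext j (fun x => F fun k => g k x) K σ0 := ⟨σ0, h0, fun i _ => Ext1.refl _⟩
    obtain ⟨τ0, h3, h4⟩ := sub σ0 hσ0
    refine ⟨τ0, h4 ▸ h0, fun k hk => ?_⟩
    exact mono_tok (hg k) hj (down σ0 hσ0 k hk) (down σ hσ' k hk)
      (fun i hi => h0' i ⟨k, hk, hi⟩) (h3 k hk) (h1 k hk)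
  refine ⟨?_, ?_, ?_, ?_, ?_, ?_, ?_, ?_, ?_⟩
  · intro x y h
    exact hF.dep _ _ fun k hk => (hg k).dep _ _ fun i hi => h i ⟨k, hk, hi⟩
  · intro σ h
    exact hF.rel _ fun k => (hg k).rel _ h
  · rintro σ h hl i ⟨k, hk, hi⟩
    exact (hg k).kill σ h (hF.kill (fun k => ap (g k) σ) (fun k => (hg k).rel _ h) hl k hk) i hi
  · rintro σ σ' h h' hl hl' hid i ⟨k, hk, hi⟩
    have r := fun k => (hg k).rel _ h
    have r' := fun k => (hg k).rel _ h'
    exact (hg k).typ σ σ' h h' (hF.kill _ r hl k hk) (hF.kill _ r' hl' k hk)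
      (hF.typ _ _ r r' hl hl' hid k hk) i hi
  · intro σ hσ
    obtain ⟨τ, h1, h2, h3⟩ := main σ hσ
    obtain ⟨t, ht⟩ := hF.ex τ h2
    exact ⟨t, h3.trans ht⟩
  · rintro σ t hσ ht i ⟨k, hk, hi⟩ c hc
    obtain ⟨τ, h1, h2, h3⟩ := main σ hσ
    obtain ⟨c1, h4, h5⟩ := (hg k).mem σ _ (down σ hσ k hk) (h1 k hk) i hi c hc
    obtain ⟨c2, h6, h7⟩ := hF.mem τ t h2 (h3.symm.trans ht) k hk c1 h4
    exact ⟨c2, h6, h5.trans h7⟩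
  · rintro σ t hσ ht hid i ⟨k, hk, hi⟩
    obtain ⟨τ, h1, h2, h3⟩ := main σ hσ
    exact (hg k).idd σ _ (down σ hσ k hk) (h1 k hk)
      (hF.idd τ t h2 (h3.symm.trans ht) hid k hk) i hi
  · intro σ t hσ ht u hu
    obtain ⟨τ, h1, h2, h3⟩ := main σ hσ
    refine hF.up τ t h2 (h3.symm.trans ht) u fun k hk => ?_
    exact (hg k).up σ _ (down σ hσ k hk) (h1 k hk) u fun i hi => hu i ⟨k, hk, hi⟩
  · intro σ σ' t t' hσ hσ' hs ht ht' u hu hc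
    obtain ⟨τ, h1, h2, h3⟩ := main σ hσ
    obtain ⟨τ', h1', h2', h3'⟩ := main σ' hσ'
    have hm : ∀ k ∈ I, Ext1 (τ k) (τ' k) := fun k hk =>
      mono_tok (hg k) hj (down σ hσ k hk) (down σ' hσ' k hk)
        (fun i hi => hs i ⟨k, hk, hi⟩) (h1 k hk) (h1' k hk)
    refine hF.cmp τ τ' t t' h2 h2' hm (h3.symm.trans ht) (h3'.symm.trans ht') u hu ?_
    intro k hk hne
    refine (hg k).cmp σ σ' _ _ (down σ hσ k hk) (down σ' hσ' k hk)
      (fun i hi => hs i ⟨k, hk, hi⟩) (h1 k hk) (h1' k hk) u ?_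
      (fun i hi => hc i ⟨k, hk, hi⟩)
    rcases hm k hk with h5 | ⟨_, c, h5⟩
    · exact absurd h5.symm hne
    · obtain ⟨c', h6, h7⟩ := hF.mem τ' t' h2' (h3'.symm.trans ht') k hk c h5
      rw [h5]
      rw [h6] at hu
      exact h7.trans hu

theorem Q_comp (hj : Function.Injective j) (a : L) {κ ι : Type*} {F : (κ → X) → X} (hF : Q j a F)
    {g : κ → (ι → X) → X} (hg : ∀ k, Q j a (g k)) : Q j a (fun x => F fun k => g k x) := by
  obtain ⟨h1, I, hI⟩ := hF
  rcases h1 with ⟨k, rfl⟩ | h1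
  · exact hg k
  choose h2 J hJ using hg
  exact ⟨Or.inr fun σ hσ => h1 (fun k => ap (g k) σ) fun k => (hJ k).rel _ hσ,
    _, core_comp hj a hI hJ⟩

theorem Q_proj (hj : Function.Injective j) (a : L) {ι : Type*} (i : ι) : Q j a (fun x : ι → X => x i) :=
  ⟨Or.inl ⟨i, rfl⟩, _, core_proj hj a i⟩

theorem Q_mono (hj : Function.Injective j) {a b : L} (hab : a ≤ b) {ι : Type*} {F : (ι → X) → X} (hF : Q j a F) :
    Q j b F := by
  obtain ⟨h1, I, hI⟩ := hF
  refine ⟨h1, I, { hI with up := ?_ }⟩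
  intro σ t hσ ht u hu
  have hl : ∀ t : Tok L, lev a t ≤ lev b t := by
    intro t; cases t <;> simp [lev, hab]
  have h2 := hI.up σ t hσ ht u fun i hi => (hl _).trans (hu i hi)
  cases t with
  | h c => exact h2
  | m c => exact h2
  | id =>
    by_cases hne : ∃ i, i ∈ I
    · obtain ⟨i, hi⟩ := hne
      have := hI.idd σ _ hσ ht rfl i hi
      have h3 := hu i hi
      rwa [this] at h3
    · rcases h1 with ⟨i, rfl⟩ | h1
      · have h3 := hI.dep (fun _ => j (.m True)) (fun _ => j (.m False))
          (fun i hi => absurd ⟨i, hi⟩ hne)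
        have h4 := hj h3
        simp at h4
      · exact absurd ht (h1 _ fun i => rel_vec _)


theorem Q_hh (hj : Function.Injective j) (a : L) : Q j a (fun x : Fin 1 → X => hh j a (x 0)) := by
  have hid : (fun d => hh j a (vec j .id d)) = vec j (.h a) := by
    funext d; exact hh_e hj a d
  -- a related vector has a live image only if it is `id`
  have key : ∀ v : L → X, Rel j v → v = vec j .id ∨ Dead j (fun d => hh j a (v d)) := by
    rintro v ((rfl | ⟨c, rfl⟩) | ⟨d, p, hd⟩)
    · exact Or.inl rfl
    · exact Or.inr ⟨⊥, False, hh_z hj a _⟩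
    · refine Or.inr ⟨d, False, ?_⟩
      simp only [hd]
      exact hh_m hj a _
  have live : ∀ σ : Fin 1 → L → X, (∀ i, Rel j (σ i)) →
      Live j (ap (fun x : Fin 1 → X => hh j a (x 0)) σ) → ∀ i, σ i = vec j .id := by
    intro σ hσ hl i
    rw [Subsingleton.elim i 0]
    rcases key _ (hσ 0) with h | h
    · exact h
    · exact absurd h (live_not_dead hj hl)
  have ext : ∀ σ, Ext j (fun x : Fin 1 → X => hh j a (x 0)) Set.univ σ → ∀ i, σ i = .id := by
    rintro σ ⟨σ0, h0, h1⟩ i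
    have h2 : σ0 i = .id := vec_inj hj (live _ (fun i => rel_vec _) h0 i)
    rcases h1 i trivial with h | h
    · rw [h, h2]
    · exact absurd h2 h.1
  have val : ∀ σ : Fin 1 → Tok L, (∀ i, σ i = .id) →
      ap (fun x : Fin 1 → X => hh j a (x 0)) (fun i => vec j (σ i)) = vec j (.h a) := by
    intro σ hσ
    rw [← hid]
    funext d
    simp only [ap, hσ]
  refine ⟨Or.inr ?_, Set.univ, ?_, ?_, ?_, ?_, ?_, ?_, ?_, ?_, ?_⟩
  · intro σ hσ h
    have h1 := live σ hσ (Or.inl h) 0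
    have h2 : vec j (.h a) = vec j .id := (hid.symm.trans (by funext d; simp only [ap, h1])).trans h
    have := vec_inj hj h2
    simp at this
  · intro x y h
    simp only [h 0 trivial]
  · intro σ hσ
    rcases key _ (hσ 0) with h | h
    · left; right
      refine ⟨a, ?_⟩
      rw [← hid, ← h]; rfl
    · exact Or.inr h
  · intro σ hσ hl i _
    exact Or.inl (live σ hσ hl i)
  · intro σ σ' hσ hσ' hl hl' _ i _
    simp [live σ hσ hl i, live σ' hσ' hl' i]
  · intro σ hσ
    exact ⟨_, val σ (ext σ hσ)⟩
  · intro σ t hσ ht i _ c hc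
    rw [ext σ hσ i] at hc
    simp at hc
  · intro σ t hσ ht _ i _
    exact ext σ hσ i
  · intro σ t hσ ht u hu
    have h1 : t = .h a := vec_inj hj (ht.symm.trans (val σ (ext σ hσ)))
    have h2 := hu 0 trivial
    rw [ext σ hσ 0] at h2
    rw [h1]; exact h2
  · intro σ σ' t t' hσ hσ' _ ht ht' u hu _
    have h1 : t = .h a := vec_inj hj (ht.symm.trans (val σ (ext σ hσ)))
    have h2 : t' = .h a := vec_inj hj (ht'.symm.trans (val σ' (ext σ' hσ')))
    rw [h1, ← h2]; exact hu

theorem le_of_Q_hh (hj : Function.Injective j) {a b : L} (h : Q j a (fun x : Fin 1 → X => hh j b (x 0))) : b ≤ a := by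
  obtain ⟨_, I, hI⟩ := h
  have hv : ap (fun x : Fin 1 → X => hh j b (x 0)) (fun _ => vec j .id) = vec j (.h b) := by
    funext d; exact hh_e hj b d
  have := hI.up (fun _ => .id) (.h b) ⟨fun _ => .id, Or.inr ⟨b, hv⟩, fun i _ => Ext1.refl _⟩ hv a
    (fun i _ => le_rfl)
  exact this

theorem core_of_dead (hj : Function.Injective j) (a : L) {ι : Type*} {F : (ι → X) → X}
    (h : ∀ σ : ι → L → X, (∀ i, Rel j (σ i)) → ¬ Live j (ap F σ))
    (hr : ∀ σ : ι → L → X, (∀ i, Rel j (σ i)) → Rel j (ap F σ)) : Core j a F Set.univ := by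
  have he : ∀ σ, ¬ Ext j F Set.univ σ := by
    rintro σ ⟨σ0, h0, _⟩
    exact h _ (fun i => rel_vec _) h0
  refine ⟨?_, hr, ?_, ?_, ?_, ?_, ?_, ?_, ?_⟩
  · intro x y hxy
    rw [show x = y from funext fun i => hxy i trivial]
  · intro σ hσ hl; exact absurd hl (h σ hσ)
  · intro σ σ' hσ _ hl; exact absurd hl (h σ hσ)
  · intro σ hσ; exact absurd hσ (he σ)
  · intro σ t hσ; exact absurd hσ (he σ)
  · intro σ t hσ; exact absurd hσ (he σ)
  · intro σ t hσ; exact absurd hσ (he σ)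
  · intro σ σ' t t' hσ; exact absurd hσ (he σ)

theorem core_subset (hj : Function.Injective j) {a b : L} {ι : Type*} {F : (ι → X) → X} {I J : Set ι}
    (hI : Core j a F I) (hJ : Core j b F J)
    {σ : ι → L → X} (hσ : ∀ i, Rel j (σ i)) (hl : Live j (ap F σ)) : I ⊆ J := by
  intro i hi
  by_contra hiJ
  have h1 : ap F (Function.update σ i (vec j (.m ⊥))) = ap F σ := by
    funext d
    refine hJ.dep _ _ fun k hk => ?_
    have : k ≠ i := fun h => hiJ (h ▸ hk)
    simp [this]
  have h2 := hI.kill (Function.update σ i (vec j (.m ⊥))) (fun k => by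
    by_cases hk : k = i
    · subst hk; simpa using rel_vec _
    · simpa [hk] using hσ k) (h1 ▸ hl) i hi
  simp only [Function.update_self] at h2
  exact live_vec hj h2 ⊥ rfl

theorem Q_inf (hj : Function.Injective j) {a b : L} {ι : Type*} {F : (ι → X) → X} (ha : Q j a F) (hb : Q j b F) :
    Q j (a ⊓ b) F := by
  obtain ⟨h1, I, hI⟩ := ha
  obtain ⟨-, J, hJ⟩ := hb
  refine ⟨h1, ?_⟩
  by_cases hl : ∃ σ : ι → L → X, (∀ i, Rel j (σ i)) ∧ Live j (ap F σ)
  swap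
  · push Not at hl
    exact ⟨_, core_of_dead hj _ hl hI.rel⟩
  obtain ⟨σ1, hσ1, hl1⟩ := hl
  obtain rfl : I = J := Set.Subset.antisymm (core_subset hj hI hJ hσ1 hl1)
    (core_subset hj hJ hI hσ1 hl1)
  refine ⟨I, { hI with up := ?_ }⟩
  intro σ t hσ ht u hu
  by_cases hid : ∃ i ∈ I, σ i = .id
  swap
  · push Not at hid
    have h2 : lev a t ≤ u := hI.up σ t hσ ht u fun i hi => by
      have h3 := hu i hi
      have h4 := hid i hi
      cases h5 : σ i with
      | id => exact absurd h5 h4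
      | h c => rw [h5] at h3; exact h3
      | m c => rw [h5] at h3; exact h3
    refine le_trans ?_ h2
    cases t <;> simp [lev]
  obtain ⟨i0, hi0, hid⟩ := hid
  have heu : a ⊓ b ≤ u := by
    have := hu i0 hi0
    rwa [hid] at this
  let ρ : ι → Tok L := fun i => if σ i = .id then .id else .m ⊥
  have hσρ : ∀ i ∈ I, Ext1 (σ i) (ρ i) := by
    intro i _
    by_cases h : σ i = .id
    · left; simp [ρ, h]
    · right; exact ⟨h, ⊥, by simp [ρ, h]⟩
  have hρ : Ext j F I ρ := by
    obtain ⟨σ0, h0, h0'⟩ := hσ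
    exact ⟨σ0, h0, fun i hi => (h0' i hi).trans (hσρ i hi)⟩
  obtain ⟨r, hr⟩ := hI.ex ρ hρ
  have hlev : ∀ c i, lev c (ρ i) ≤ c := by
    intro c i
    by_cases h : σ i = .id <;> simp [ρ, h, lev]
  have ra : lev a r ≤ a := hI.up ρ r hρ hr a fun i _ => hlev a i
  have rb : lev b r ≤ b := hJ.up ρ r hρ hr b fun i _ => hlev b i
  have re : lev ⊥ r ≤ u := by
    refine le_trans (le_inf ?_ ?_) heu
    · cases r <;> simp [lev] at ra ⊢ <;> assumption
    · cases r <;> simp [lev] at rb ⊢ <;> assumption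
  have hfin := hI.cmp σ ρ t r hσ hρ hσρ ht hr u re (fun i hi _ => by
    refine le_trans ?_ (hu i hi)
    cases σ i <;> simp [lev])
  cases t with
  | id => exact heu
  | h c => exact hfin
  | m c => exact hfin

/-- The index set of the relevant variables of the operation `HH` below. -/
def KK {ι : Type*} (I Y : Set ι) : Set (ι ⊕ (ι ⊕ ι))
  | .inl i => i ∈ I
  | .inr (.inl i) => i ∈ Y
  | .inr (.inr i) => i ∈ Y

end

section
variable {L : Type u} [Lattice L] [OrderBot L] {X : Type v} (j : W L → X)

def Match (a b : L) {ι : Type*} (Y : Set ι) (v : ι ⊕ (ι ⊕ ι) → X) : Prop :=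
  ∀ i ∈ Y, v (.inr (.inl i)) = hh j a (v (.inl i)) ∧ v (.inr (.inr i)) = hh j b (v (.inl i))

noncomputable def HH (a b : L) {ι : Type*} (I Y : Set ι) (f : (ι → X) → X)
    (v : ι ⊕ (ι ⊕ ι) → X) : X :=
  if Match j a b Y v then f (fun i => v (.inl i)) else j (.m (∃ k ∈ KK I Y, N j (v k)))

end

theorem Q_HH {L : Type u} [Lattice L] [OrderBot L] {X : Type v} {j : W L → X}
    (hj : Function.Injective j) {a b : L} {ι : Type*} [Finite ι] {f : (ι → X) → X} {I : Set ι}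
    (hf : Core j (a ⊔ b) f I) (hno : NoId j f) (Y : Set ι)
    (hY : Y = {i | i ∈ I ∧ ∃ σ : ι → L → X, (∀ i, Rel j (σ i)) ∧ Live j (ap f σ) ∧
      σ i = vec j .id}) : Q j ⊥ (HH j a b I Y f) := by
  have : Fintype ι := Fintype.ofFinite ι
  -- a non-dead result is matched everywhere
  have nd : ∀ σ : ι ⊕ (ι ⊕ ι) → L → X, ¬ Dead j (ap (HH j a b I Y f) σ) →
      (∀ d, Match j a b Y fun k => σ k d) ∧
      ap (HH j a b I Y f) σ = ap f fun i => σ (.inl i) := by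
    intro σ hσ
    have h1 : ∀ d, Match j a b Y fun k => σ k d := by
      intro d
      by_contra hd
      exact hσ ⟨d, _, if_neg hd⟩
    exact ⟨h1, funext fun d => if_pos (h1 d)⟩
  have typ : ∀ σ : ι → L → X, (∀ i, Rel j (σ i)) → Live j (ap f σ) → ∀ i ∈ Y,
      σ i = vec j .id := by
    intro σ hσ hl i hi
    rw [hY] at hi
    obtain ⟨hi, σ', hσ', hl', hid⟩ := hi
    refine (hf.typ σ σ' hσ hσ' hl hl' ?_ i hi).2 hid
    simp [hno σ hσ, hno σ' hσ']
  have hhid : ∀ c, (fun d => hh j c (vec j .id d)) = vec j (.h c) := by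
    intro c; funext d; exact hh_e hj c d
  have live : ∀ σ : ι ⊕ (ι ⊕ ι) → L → X, (∀ k, Rel j (σ k)) →
      Live j (ap (HH j a b I Y f) σ) → Live j (ap f fun i => σ (.inl i)) ∧
      ∀ i ∈ Y, σ (.inl i) = vec j .id ∧ σ (.inr (.inl i)) = vec j (.h a) ∧
        σ (.inr (.inr i)) = vec j (.h b) := by
    intro σ hσ hl
    obtain ⟨h1, h2⟩ := nd σ (live_not_dead hj hl)
    have h3 : Live j (ap f fun i => σ (.inl i)) := h2 ▸ hl
    refine ⟨h3, fun i hi => ?_⟩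
    have h4 := typ _ (fun i => hσ (.inl i)) h3 i hi
    refine ⟨h4, ?_, ?_⟩
    · rw [← hhid, ← h4]; funext d; exact (h1 d i hi).1
    · rw [← hhid, ← h4]; funext d; exact (h1 d i hi).2
  have ext : ∀ σ : ι ⊕ (ι ⊕ ι) → Tok L, Ext j (HH j a b I Y f) (KK I Y) σ →
      Ext j f I (fun i => σ (.inl i)) ∧ (∀ i ∈ I, σ (.inl i) = .id → i ∈ Y) ∧
      ∀ i ∈ Y, σ (.inl i) = .id ∧ Ext1 (.h a) (σ (.inr (.inl i))) ∧
        Ext1 (.h b) (σ (.inr (.inr i))) := by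
    rintro σ ⟨σ0, h0, h1⟩
    obtain ⟨h2, h3⟩ := live _ (fun k => rel_vec _) h0
    refine ⟨⟨fun i => σ0 (.inl i), h2, fun i hi => h1 (.inl i) hi⟩, ?_, ?_⟩
    · intro i hi hid
      rw [hY]
      refine ⟨hi, fun i => vec j (σ0 (.inl i)), fun i => rel_vec _, h2, ?_⟩
      have h4 := h1 (.inl i) hi
      rw [hid] at h4
      rcases h4 with h4 | ⟨_, c, h4⟩
      · simp only [← h4]
      · simp at h4
    · intro i hi
      obtain ⟨h4, h5, h6⟩ := h3 i hi
      have h4 := vec_inj hj h4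
      have h5 := vec_inj hj h5
      have h6 := vec_inj hj h6
      refine ⟨?_, h5 ▸ h1 (.inr (.inl i)) hi, h6 ▸ h1 (.inr (.inr i)) hi⟩
      have hiI : i ∈ I := by rw [hY] at hi; exact hi.1
      rcases h1 (.inl i) hiI with h7 | h7
      · rw [h7, h4]
      · exact absurd h4 h7.1
  let B : (ι ⊕ (ι ⊕ ι) → Tok L) → Prop := fun σ =>
    ∀ i ∈ Y, σ (.inr (.inl i)) = .h a ∧ σ (.inr (.inr i)) = .h b
  let s : (ι ⊕ (ι ⊕ ι) → Tok L) → L := fun σ =>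
    Finset.univ.sup fun k => if k ∈ KK I Y then lev ⊥ (σ k) else ⊥
  have s_le : ∀ σ u, s σ ≤ u ↔ ∀ k ∈ KK I Y, lev ⊥ (σ k) ≤ u := by
    intro σ u
    simp only [s, Finset.sup_le_iff, Finset.mem_univ, true_imp_iff]
    refine forall_congr' fun k => ?_
    by_cases hk : k ∈ KK I Y <;> simp [hk]
  have valB : ∀ σ, Ext j (HH j a b I Y f) (KK I Y) σ → B σ →
      ap (HH j a b I Y f) (fun k => vec j (σ k)) = ap f (fun i => vec j (σ (.inl i))) := by
    intro σ hσ hB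
    obtain ⟨_, _, h3⟩ := ext σ hσ
    funext d
    refine if_pos fun i hi => ?_
    simp only [(hB i hi).1, (hB i hi).2, (h3 i hi).1]
    exact ⟨(congrFun (hhid a) d).symm, (congrFun (hhid b) d).symm⟩
  have valA : ∀ σ, Ext j (HH j a b I Y f) (KK I Y) σ → ¬ B σ →
      ap (HH j a b I Y f) (fun k => vec j (σ k)) = vec j (.m (s σ)) := by
    intro σ hσ hB
    obtain ⟨_, _, h3⟩ := ext σ hσ
    funext d
    have h4 : ¬ Match j a b Y (fun k => vec j (σ k) d) := by
      intro hm
      apply hB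
      intro i hi
      have h5 := hm i hi
      simp only [(h3 i hi).1] at h5
      constructor
      · rcases (h3 i hi).2.1 with h | ⟨_, c, h⟩
        · exact h
        · rw [h] at h5
          have h6 := hj (h5.1.trans (hh_e hj a d))
          simp [wvec] at h6
      · rcases (h3 i hi).2.2 with h | ⟨_, c, h⟩
        · exact h
        · rw [h] at h5
          have h6 := hj (h5.2.trans (hh_e hj b d))
          simp [wvec] at h6
    refine (if_neg h4).trans ?_
    simp only [vec, wvec]
    congr 2
    rw [s_le]
    push Not
    refine propext (exists_congr fun k => and_congr_right fun _ => ?_)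
    exact N_vec hj _ _
  have upH : ∀ (σ : ι ⊕ (ι ⊕ ι) → Tok L) (t : Tok L), Ext j (HH j a b I Y f) (KK I Y) σ →
      ap (HH j a b I Y f) (fun i => vec j (σ i)) = vec j t →
      ∀ u, (∀ i ∈ KK I Y, lev ⊥ (σ i) ≤ u) → lev ⊥ t ≤ u := by
    intro σ t hσ ht u hu
    by_cases hB : B σ
    · obtain ⟨h1, h2, h3⟩ := ext σ hσ
      have h4 := hf.up _ t h1 ((valB σ hσ hB).symm.trans ht) u (fun i hi => by
        have h5 := hu (.inl i) hi
        cases h6 : σ (.inl i) with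
        | id =>
          have hiY := h2 i hi h6
          have h7 := hu (.inr (.inl i)) hiY
          have h8 := hu (.inr (.inr i)) hiY
          rw [(hB i hiY).1] at h7
          rw [(hB i hiY).2] at h8
          exact sup_le h7 h8
        | h c => rw [h6] at h5; exact h5
        | m c => rw [h6] at h5; exact h5)
      refine le_trans ?_ h4
      cases t <;> simp [lev]
    · have : t = .m (s σ) := vec_inj hj (ht.symm.trans (valA σ hσ hB))
      rw [this]
      exact (s_le σ u).2 hu
  have noH : NoId j (HH j a b I Y f) := by
    intro σ hσ hid
    have h1 := nd σ (live_not_dead hj (Or.inl hid))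
    exact hno _ (fun i => hσ (.inl i)) (h1.2 ▸ hid)
  refine ⟨Or.inr noH, KK I Y, ?_, ?_, ?_, ?_, ?_, ?_, ?_, upH, ?_⟩
  · intro x y hxy
    have hYI : ∀ i ∈ Y, i ∈ I := by intro i hi; rw [hY] at hi; exact hi.1
    have h1 : Match j a b Y x ↔ Match j a b Y y := by
      refine forall_congr' fun i => imp_congr_right fun hi => ?_
      rw [hxy (.inl i) (hYI i hi), hxy (.inr (.inl i)) hi, hxy (.inr (.inr i)) hi]
    have h2 : f (fun i => x (.inl i)) = f (fun i => y (.inl i)) :=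
      hf.dep _ _ fun i hi => hxy (.inl i) hi
    have h3 : (∃ k ∈ KK I Y, N j (x k)) = (∃ k ∈ KK I Y, N j (y k)) :=
      propext (exists_congr fun k => and_congr_right fun hk => by rw [hxy k hk])
    simp only [HH, h1, h2, h3]
  · intro σ hσ
    by_cases hd : Dead j (ap (HH j a b I Y f) σ)
    · exact Or.inr hd
    · rw [(nd σ hd).2]
      exact hf.rel _ fun i => hσ (.inl i)
  · rintro σ hσ hl (i | i | i) hi
    · exact hf.kill _ (fun i => hσ (.inl i)) (live σ hσ hl).1 i hi
    · exact Or.inr ⟨a, ((live σ hσ hl).2 i hi).2.1⟩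
    · exact Or.inr ⟨b, ((live σ hσ hl).2 i hi).2.2⟩
  · rintro σ σ' hσ hσ' hl hl' _ (i | i | i) hi
    · refine hf.typ _ _ (fun i => hσ (.inl i)) (fun i => hσ' (.inl i)) (live σ hσ hl).1
        (live σ' hσ' hl').1 ?_ i hi
      simp [hno _ (fun i => hσ (.inl i)), hno _ (fun i => hσ' (.inl i))]
    · rw [((live σ hσ hl).2 i hi).2.1, ((live σ' hσ' hl').2 i hi).2.1]
    · rw [((live σ hσ hl).2 i hi).2.2, ((live σ' hσ' hl').2 i hi).2.2]
  · intro σ hσ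
    by_cases hB : B σ
    · rw [valB σ hσ hB]
      exact hf.ex _ (ext σ hσ).1
    · exact ⟨_, valA σ hσ hB⟩
  · intro σ t hσ ht k hk c hc
    by_cases hB : B σ
    · rcases k with i | i | i
      · exact hf.mem _ t (ext σ hσ).1 ((valB σ hσ hB).symm.trans ht) i hk c hc
      · rw [(hB i hk).1] at hc; simp at hc
      · rw [(hB i hk).2] at hc; simp at hc
    · refine ⟨s σ, vec_inj hj (ht.symm.trans (valA σ hσ hB)), ?_⟩
      have h1 := (s_le σ (s σ)).1 le_rfl k hk
      rw [hc] at h1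
      exact h1
  · intro σ t hσ ht hid
    exact absurd (hid ▸ ht) (noH _ fun k => rel_vec _)
  · intro σ σ' t t' hσ hσ' hs ht ht' u hu hc
    by_cases hB' : B σ'
    · have hB : B σ := by
        intro i hi
        obtain ⟨_, _, h3⟩ := ext σ hσ
        have h4 := hs (.inr (.inl i)) hi
        have h5 := hs (.inr (.inr i)) hi
        rw [(hB' i hi).1] at h4
        rw [(hB' i hi).2] at h5
        constructor
        · rcases h4 with h | ⟨_, c, h⟩
          · exact h.symm
          · simp at h
        · rcases h5 with h | ⟨_, c, h⟩
          · exact h.symm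
          · simp at h
      exact hf.cmp _ _ t t' (ext σ hσ).1 (ext σ' hσ').1 (fun i hi => hs (.inl i) hi)
        ((valB σ hσ hB).symm.trans ht) ((valB σ' hσ' hB').symm.trans ht') u hu
        (fun i hi => hc (.inl i) hi)
    · refine upH σ t hσ ht u fun k hk => ?_
      by_cases hk' : σ k = σ' k
      · have h1 : t' = .m (s σ') := vec_inj hj (ht'.symm.trans (valA σ' hσ' hB'))
        rw [h1] at hu
        rw [hk']
        exact (s_le σ' u).1 hu k hk
      · exact hc k hk hk'

/-- The clone attached to a lattice element. -/
def QC {L : Type u} [Lattice L] [OrderBot L] {X : Type v} {j : W L → X}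
    (hj : Function.Injective j) (a : L) : Clone X where
  carrier n := {F | Q j a F}
  proj_mem n i := Q_proj hj a i
  comp_mem f g hf hg := Q_comp hj a hf hg

theorem QC_sup_le {L : Type u} [Lattice L] [OrderBot L] {X : Type v} {j : W L → X}
    (hj : Function.Injective j) (a b : L) (D : Clone X) (ha : QC hj a ≤ D) (hb : QC hj b ≤ D) :
    QC hj (a ⊔ b) ≤ D := by
  rintro n f ⟨h1, I, hI⟩
  rcases h1 with ⟨i, rfl⟩ | h1
  · exact D.proj_mem n i
  have hH := Q_HH hj hI h1 _ rfl
  set Y : Set (Fin (n + 1)) := {i | i ∈ I ∧ ∃ σ : Fin (n + 1) → L → X,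
    (∀ i, Rel j (σ i)) ∧ Live j (ap f σ) ∧ σ i = vec j .id} with hY
  -- reindex by `Fin`
  obtain ⟨N, ⟨eqv⟩⟩ : ∃ N, Nonempty (Fin (n + 1) ⊕ (Fin (n + 1) ⊕ Fin (n + 1)) ≃ Fin (N + 1)) :=
    ⟨n + ((n + 1) + n) + 1, ⟨(Fintype.equivFin _).trans (finCongr (by simp; omega))⟩⟩
  have hH' : Q j ⊥ (fun x : Fin (N + 1) → X => HH j a b I Y f fun k => x (eqv k)) :=
    Q_comp hj ⊥ hH fun k => Q_proj hj ⊥ (eqv k)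
  have hHD := ha N (Q_mono hj bot_le hH' : Q j a _)
  have hhD : ∀ c, QC hj c ≤ D → ∀ i : Fin (n + 1),
      (fun x : Fin (n + 1) → X => hh j c (x i)) ∈ D.carrier n := by
    intro c hc i
    exact D.comp_mem (fun x : Fin 1 → X => hh j c (x 0)) (fun _ x => x i) (hc 0 (Q_hh hj c))
      (fun _ => D.proj_mem n i)
  let g0 : Fin (n + 1) ⊕ (Fin (n + 1) ⊕ Fin (n + 1)) → (Fin (n + 1) → X) → X
    | .inl i => fun x => x i
    | .inr (.inl i) => fun x => hh j a (x i)
    | .inr (.inr i) => fun x => hh j b (x i)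
  have hg0 : ∀ k, g0 k ∈ D.carrier n := by
    rintro (i | i | i)
    · exact D.proj_mem n i
    · exact hhD a ha i
    · exact hhD b hb i
  have := D.comp_mem _ (fun k => g0 (eqv.symm k)) hHD (fun k => hg0 _)
  convert this using 1
  funext x
  simp only [Equiv.symm_apply_apply]
  have hm : Match j a b Y (fun k => g0 k x) := fun i _ => ⟨rfl, rfl⟩
  exact (if_pos hm).symm

theorem exists_inj {L : Type u} [Finite L] {X : Type v} [Finite X]
    (hcard : Nat.card L + 4 ≤ Nat.card X) : ∃ j : W L → X, Function.Injective j := by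
  let φ : W L → L ⊕ (Prop ⊕ Prop)
    | .e d => .inl d
    | .z p => .inr (.inl p)
    | .m p => .inr (.inr p)
  have hφ : Function.Injective φ := by
    rintro (d | p | p) (d' | p' | p') h <;> simp [φ] at h ⊢ <;> exact h
  have : Fintype L := Fintype.ofFinite L
  have : Fintype X := Fintype.ofFinite X
  obtain ⟨g⟩ : Nonempty (L ⊕ (Prop ⊕ Prop) ↪ X) := by
    apply Function.Embedding.nonempty_of_card_le
    simp only [Nat.card_eq_fintype_card] at hcard
    simpa using hcard
  exact ⟨g ∘ φ, g.injective.comp hφ⟩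

end CloneEmb

/-- Every finite lattice is a sublattice of the clone lattice over a finite set `X`
with `|X| ≥ |L| + 4`: there is an injective map preserving binary joins and meets. -/
theorem finite_lattice_embeds_into_finite_clone_lattice
    {L : Type u} [Lattice L] [Finite L] {X : Type v} [Finite X]
    (hcard : Nat.card L + 4 ≤ Nat.card X) :
    ∃ f : L → Clone X, Function.Injective f ∧
      (∀ a b : L, f (a ⊔ b) = f a ⊔ f b) ∧
      (∀ a b : L, f (a ⊓ b) = f a ⊓ f b) := by
  rcases isEmpty_or_nonempty L with hL | hL
  · exact ⟨fun a => isEmptyElim a, fun a => isEmptyElim a, fun a => isEmptyElim a,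
      fun a => isEmptyElim a⟩
  have : Fintype L := Fintype.ofFinite L
  letI : OrderBot L := Fintype.toOrderBot L
  obtain ⟨j, hj⟩ := CloneEmb.exists_inj hcard
  have mono : ∀ a b : L, a ≤ b → CloneEmb.QC hj a ≤ CloneEmb.QC hj b :=
    fun a b hab n F hF => CloneEmb.Q_mono hj hab hF
  have refl : ∀ a b : L, CloneEmb.QC hj a ≤ CloneEmb.QC hj b → a ≤ b :=
    fun a b h => CloneEmb.le_of_Q_hh hj (h 0 (CloneEmb.Q_hh hj a))
  refine ⟨CloneEmb.QC hj, ?_, ?_, ?_⟩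
  · intro a b h
    exact le_antisymm (refl a b h.le) (refl b a h.ge)
  · intro a b
    apply le_antisymm
    · exact CloneEmb.QC_sup_le hj a b _ le_sup_left le_sup_right
    · exact sup_le (mono _ _ le_sup_left) (mono _ _ le_sup_right)
  · intro a b
    apply le_antisymm
    · exact le_inf (mono _ _ inf_le_left) (mono _ _ inf_le_right)
    · intro n F hF
      have h1 : CloneEmb.QC hj a ⊓ CloneEmb.QC hj b ≤ CloneEmb.QC hj a := inf_le_left
      have h2 : CloneEmb.QC hj a ⊓ CloneEmb.QC hj b ≤ CloneEmb.QC hj b := inf_le_right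
      exact CloneEmb.Q_inf hj (h1 n hF) (h2 n hF)
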